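/- arXiv:0810.0801 — 2 statements merged into one kernel-verified Lean document; each statement's English description precedes it below -/
import Mathlib

section
/- Let G and H be two finite simple graphs on the same vertex set. Then |E(H) − E(G)| ≤ 2·Δ(G,H), where Δ(G,H) = |E(G)| + |E(H)| − 2|E(G) ∩ E(H)| is the number of edges in the symmetric difference of the edge sets of G and H. -/
open Real Filter SimpleGraph

/-- The adjacency matrix of a simple graph over `ℝ` is Hermitian (it is symmetric). -/
lemma adjMatrix_isHermitian {V : Type*} [Fintype V] [DecidableEq V]
    (G : SimpleGraph V) [DecidableRel G.Adj] : (G.adjMatrix ℝ).IsHermitian := by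
  unfold Matrix.IsHermitian
  rw [Matrix.conjTranspose_eq_transpose_of_trivial]
  exact G.isSymm_adjMatrix

/-- The eigenvalues (with multiplicity, indexed by the vertices) of the adjacency
matrix of a finite simple graph, regarded as a real symmetric matrix. -/
noncomputable def graphEigenvalues {V : Type*} [Fintype V] [DecidableEq V]
    (G : SimpleGraph V) : V → ℝ :=
  letI := Classical.decRel G.Adj
  (adjMatrix_isHermitian G).eigenvalues

/-- The energy of a finite simple graph: the sum of the absolute values of the
eigenvalues (with multiplicity) of its adjacency matrix. -/
noncomputable def graphEnergy {V : Type*} [Fintype V] [DecidableEq V]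
    (G : SimpleGraph V) : ℝ :=
  ∑ v, |graphEigenvalues G v|

open Matrix in
/-- The trace of the product of an orthogonal matrix with a real symmetric matrix is at most the
sum of the absolute values of the eigenvalues of the latter. -/
lemma trace_unitary_mul_le_sum_abs_eigenvalues {n : Type*} [Fintype n] [DecidableEq n]
    {S A : Matrix n n ℝ} (hS : S ∈ unitaryGroup n ℝ) (hA : A.IsHermitian) :
    (S * A).trace ≤ ∑ i, |hA.eigenvalues i| := by
  set U := hA.eigenvectorUnitary
  have hW : star (U : Matrix n n ℝ) * S * U ∈ unitaryGroup n ℝ :=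
    mul_mem (mul_mem (Unitary.star_mem U.2) hS) U.2
  have h : (S * A).trace =
      (star (U : Matrix n n ℝ) * S * U * diagonal hA.eigenvalues).trace := by
    conv_lhs => rw [hA.spectral_theorem, Unitary.conjStarAlgAut_apply]
    rw [← mul_assoc, trace_mul_comm]
    simp only [mul_assoc]
    rfl
  rw [h, trace]
  refine Finset.sum_le_sum fun i _ => ?_
  rw [diag_apply, mul_diagonal]
  have hle := entry_norm_bound_of_unitary hW i i
  rw [Real.norm_eq_abs] at hle
  calc _ ≤ |(star (U : Matrix n n ℝ) * S * U) i i * hA.eigenvalues i| := le_abs_self _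
    _ ≤ 1 * |hA.eigenvalues i| := by rw [abs_mul]; gcongr
    _ = _ := one_mul _

open Matrix in
/-- The sum of the absolute values of the eigenvalues of a real symmetric matrix is attained as
the trace of its product with some orthogonal matrix. -/
lemma exists_unitary_trace_mul_eq_sum_abs_eigenvalues {n : Type*} [Fintype n] [DecidableEq n]
    {A : Matrix n n ℝ} (hA : A.IsHermitian) :
    ∃ S ∈ unitaryGroup n ℝ, (S * A).trace = ∑ i, |hA.eigenvalues i| := by
  set U := hA.eigenvectorUnitary
  set D : Matrix n n ℝ := diagonal fun i => if 0 ≤ hA.eigenvalues i then 1 else -1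
  have hD : D ∈ unitaryGroup n ℝ := by
    rw [mem_unitaryGroup_iff, star_eq_conjTranspose, diagonal_conjTranspose, diagonal_mul_diagonal,
      ← diagonal_one]
    congr 1
    ext i
    by_cases h : 0 ≤ hA.eigenvalues i <;> simp [h]
  refine ⟨U * D * star (U : Matrix n n ℝ),
    mul_mem (mul_mem U.2 hD) (Unitary.star_mem U.2), ?_⟩
  have h : (U * D * star (U : Matrix n n ℝ) * A).trace =
      (D * diagonal hA.eigenvalues).trace := by
    conv_lhs => rw [hA.spectral_theorem, Unitary.conjStarAlgAut_apply]
    have hU : star (U : Matrix n n ℝ) * U = 1 := Unitary.star_mul_self_of_mem U.2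
    rw [← mul_assoc, trace_mul_comm]
    calc _ = ((star (U : Matrix n n ℝ) * U) * D * (star (U : Matrix n n ℝ) * U) *
          diagonal hA.eigenvalues).trace := by
          simp only [mul_assoc]
          rfl
      _ = _ := by rw [hU, one_mul, mul_one]
  rw [h, diagonal_mul_diagonal, trace_diagonal]
  refine Finset.sum_congr rfl fun i _ => ?_
  split_ifs with h0
  · rw [one_mul, abs_of_nonneg h0]
  · rw [neg_one_mul, abs_of_neg (not_le.mp h0)]

open Matrix in
/-- The trace norm of real symmetric matrices is Lipschitz with respect to the entrywise
`ℓ¹` distance. -/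
lemma sum_abs_eigenvalues_sub_le {n : Type*} [Fintype n] [DecidableEq n]
    {A B : Matrix n n ℝ} (hA : A.IsHermitian) (hB : B.IsHermitian) :
    ∑ i, |hA.eigenvalues i| - ∑ i, |hB.eigenvalues i| ≤ ∑ i, ∑ j, |A i j - B i j| := by
  obtain ⟨S, hS, hSA⟩ := exists_unitary_trace_mul_eq_sum_abs_eigenvalues hA
  have hSB := trace_unitary_mul_le_sum_abs_eigenvalues hS hB
  have hdiff : (S * (A - B)).trace ≤ ∑ i, ∑ j, |A i j - B i j| := by
    rw [Finset.sum_comm, trace]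
    simp only [diag_apply, mul_apply, Matrix.sub_apply]
    rw [Finset.sum_comm, Finset.sum_comm (f := fun j i => |A i j - B i j|)]
    refine Finset.sum_le_sum fun i _ => Finset.sum_le_sum fun j _ => ?_
    have hle := entry_norm_bound_of_unitary hS j i
    rw [Real.norm_eq_abs] at hle
    calc _ ≤ |S j i * (A i j - B i j)| := le_abs_self _
      _ ≤ 1 * |A i j - B i j| := by rw [abs_mul]; gcongr
      _ = _ := one_mul _
  rw [mul_sub, trace_sub] at hdiff
  linarith

/-- The entries of the adjacency matrix sum to twice the number of edges. -/
lemma sum_sum_adjMatrix {V : Type*} [Fintype V] [DecidableEq V]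
    (G : SimpleGraph V) [DecidableRel G.Adj] :
    ∑ i, ∑ j, G.adjMatrix ℝ i j = 2 * (G.edgeFinset.card : ℝ) := by
  have h := G.sum_degrees_eq_twice_card_edges
  have h' : ((∑ v, G.degree v : ℕ) : ℝ) = 2 * (G.edgeFinset.card : ℝ) := by
    rw [h]; push_cast; rfl
  rw [← h', Nat.cast_sum]
  refine Finset.sum_congr rfl fun i _ => ?_
  simp [adjMatrix_apply, Finset.sum_boole, ← card_neighborFinset_eq_degree,
    neighborFinset_eq_filter]

/-- The entrywise `ℓ¹` distance of two adjacency matrices is twice the size of the symmetric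
difference of the edge sets. -/
lemma sum_sum_abs_adjMatrix_sub {V : Type*} [Fintype V] [DecidableEq V]
    (G H : SimpleGraph V) [DecidableRel G.Adj] [DecidableRel H.Adj] :
    ∑ i, ∑ j, |H.adjMatrix ℝ i j - G.adjMatrix ℝ i j| =
      2 * ((G.edgeFinset.card : ℝ) + (H.edgeFinset.card : ℝ) -
        2 * ((G.edgeFinset ∩ H.edgeFinset).card : ℝ)) := by
  have hentry : ∀ i j, |H.adjMatrix ℝ i j - G.adjMatrix ℝ i j| =
      G.adjMatrix ℝ i j + H.adjMatrix ℝ i j - 2 * (G ⊓ H).adjMatrix ℝ i j := by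
    intro i j
    by_cases hG : G.Adj i j <;> by_cases hH : H.Adj i j <;>
      norm_num [adjMatrix_apply, hG, hH]
  simp only [hentry, Finset.sum_sub_distrib, Finset.sum_add_distrib, ← Finset.mul_sum,
    sum_sum_adjMatrix]
  have hinf : @edgeFinset V (G ⊓ H) (G ⊓ H).fintypeEdgeSet = G.edgeFinset ∩ H.edgeFinset := by
    ext e
    simp
  rw [hinf]
  ring

/-- Graph energy can be computed with any decidability instance on adjacency. -/
lemma graphEnergy_eq_sum_abs_eigenvalues {V : Type*} [Fintype V] [DecidableEq V]
    (G : SimpleGraph V) [DecidableRel G.Adj] :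
    graphEnergy G = ∑ v, |(adjMatrix_isHermitian G).eigenvalues v| := by
  unfold graphEnergy graphEigenvalues
  congr!

/-- for two graphs `G`, `H` on the same vertex set,
`|E(H) − E(G)| ≤ 2·Δ(G,H)` where `Δ(G,H) = |E(G)| + |E(H)| − 2|E(G) ∩ E(H)|`
is the number of edges in the symmetric difference of the edge sets. -/
theorem energy_diff_le_two_symmDiff {V : Type*} [Fintype V] [DecidableEq V]
    (G H : SimpleGraph V) [DecidableRel G.Adj] [DecidableRel H.Adj] :
    |graphEnergy H - graphEnergy G| ≤
      2 * ((G.edgeFinset.card : ℝ) + (H.edgeFinset.card : ℝ) -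
        2 * ((G.edgeFinset ∩ H.edgeFinset).card : ℝ)) := by
  simp only [graphEnergy_eq_sum_abs_eigenvalues]
  have hGH := sum_abs_eigenvalues_sub_le (adjMatrix_isHermitian G) (adjMatrix_isHermitian H)
  have hHG := sum_abs_eigenvalues_sub_le (adjMatrix_isHermitian H) (adjMatrix_isHermitian G)
  simp only [abs_sub_comm (G.adjMatrix ℝ _ _)] at hGH
  rw [sum_sum_abs_adjMatrix_sub] at hGH hHG
  rw [abs_le]
  constructor <;> linarith
end

section
/- For the toroidal triangular lattice T^t(n,m), the energy per vertex converges as n, m → ∞ (jointly, i.e., along the product filter): lim_{n,m→∞} E(T^t(n,m))/(nm) = (1/(2π²)) ∫₀^{2π} ∫₀^{2π} |cos x + cos y + cos(x+y)| dx dy. -/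
open Real Filter SimpleGraph

/-- The toroidal triangular lattice `T^t(n,m)`: the simple graph on
`(ℤ/nℤ) × (ℤ/mℤ)` in which `(i,j)` is adjacent to `(i±1,j)`, `(i,j±1)`,
`(i+1,j+1)` and `(i−1,j−1)`. -/
def triTorus (n m : ℕ) : SimpleGraph (ZMod n × ZMod m) :=
  SimpleGraph.fromRel fun u v =>
    (v.1 = u.1 + 1 ∧ v.2 = u.2) ∨ (v.1 = u.1 ∧ v.2 = u.2 + 1) ∨
      (v.1 = u.1 + 1 ∧ v.2 = u.2 + 1)

/-- The energy of `T^t(n,m)` as a function of `n, m` (junk value `0` when `n = 0`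
or `m = 0`, where `ℤ/nℤ` is infinite). -/
noncomputable def triTorusEnergy : ℕ → ℕ → ℝ
  | 0, _ => 0
  | _ + 1, 0 => 0
  | n + 1, m + 1 => graphEnergy (triTorus (n + 1) (m + 1))

lemma triTorusEnergy_eq_graphEnergy (n m : ℕ) [NeZero n] [NeZero m] :
    triTorusEnergy n m = graphEnergy (triTorus n m) := by
  obtain ⟨n, rfl⟩ := Nat.exists_eq_succ_of_ne_zero (NeZero.ne n)
  obtain ⟨m, rfl⟩ := Nat.exists_eq_succ_of_ne_zero (NeZero.ne m)
  rw [triTorusEnergy]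

/-- A real symmetric matrix that is diagonalized over `ℂ` with real diagonal `d` has spectrum `d`. -/
lemma Matrix.IsHermitian.map_eigenvalues_eq_of_mul_eq_mul_diagonal {V : Type*} [Fintype V]
    [DecidableEq V] {A : Matrix V V ℝ} (hA : A.IsHermitian) (P Q : Matrix V V ℂ) (d : V → ℝ)
    (hPQ : P * Q = 1)
    (h : A.map Complex.ofReal * P = P * Matrix.diagonal (fun v => (d v : ℂ))) :
    Finset.univ.val.map hA.eigenvalues = Finset.univ.val.map d := by
  have hQP : Q * P = 1 := mul_eq_one_comm.mp hPQ
  have h1 : (A.map Complex.ofReal).charpoly = (Matrix.diagonal (fun v => (d v : ℂ))).charpoly := by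
    rw [← mul_one (A.map Complex.ofReal), ← hPQ, ← mul_assoc, h, Matrix.charpoly_mul_comm,
      ← mul_assoc, hQP, one_mul]
  have h2 : A.charpoly = ∏ v, (Polynomial.X - Polynomial.C (d v)) := by
    apply Polynomial.map_injective Complex.ofRealHom Complex.ofReal_injective
    rw [← Matrix.charpoly_map, Polynomial.map_prod]
    simp only [Polynomial.map_sub, Polynomial.map_X, Polynomial.map_C]
    exact h1.trans (Matrix.charpoly_diagonal _)
  have h3 := hA.roots_charpoly_eq_eigenvalues
  have h4 : (∏ v, (Polynomial.X - Polynomial.C (d v))).roots = Finset.univ.val.map d := by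
    rw [Finset.prod, ← Polynomial.roots_multiset_prod_X_sub_C (Finset.univ.val.map d),
      Multiset.map_map]
    rfl
  rw [h2, h4] at h3
  exact h3.symm

/-- The character of `(ℤ/nℤ) × (ℤ/mℤ)` with frequency `k`. -/
noncomputable def torusChar {n m : ℕ} [NeZero n] [NeZero m] (k v : ZMod n × ZMod m) : ℂ :=
  ZMod.stdAddChar (k.1 * v.1) * ZMod.stdAddChar (k.2 * v.2)

lemma torusChar_add {n m : ℕ} [NeZero n] [NeZero m] (k u v : ZMod n × ZMod m) :
    torusChar k (u + v) = torusChar k u * torusChar k v := by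
  simp only [torusChar, Prod.fst_add, Prod.snd_add, mul_add, AddChar.map_add_eq_mul]
  ring

lemma sum_torusChar {n m : ℕ} [NeZero n] [NeZero m] (v : ZMod n × ZMod m) :
    ∑ k, torusChar k v = if v = 0 then (n * m : ℂ) else 0 := by
  simp only [torusChar, Fintype.sum_prod_type]
  rw [← Finset.sum_mul_sum, AddChar.sum_mulShift _ (ZMod.isPrimitive_stdAddChar n),
    AddChar.sum_mulShift _ (ZMod.isPrimitive_stdAddChar m)]
  by_cases h1 : v.1 = 0 <;> by_cases h2 : v.2 = 0 <;> simp [h1, h2, Prod.ext_iff, ZMod.card]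

/-- The eigenvalue symbol of the triangular lattice, divided by `2`. -/
noncomputable def triSymbol (x y : ℝ) : ℝ := Real.cos x + Real.cos y + Real.cos (x + y)

lemma ZMod.stdAddChar_eq_exp {n : ℕ} [NeZero n] (k : ZMod n) :
    ZMod.stdAddChar k = Complex.exp ((2 * π * (k.val / n) : ℝ) * Complex.I) := by
  rw [ZMod.stdAddChar_apply, ZMod.toCircle_apply]
  push_cast
  congr 1
  ring

lemma sum_torusChar_steps {n m : ℕ} [NeZero n] [NeZero m] (k : ZMod n × ZMod m) :
    torusChar k (1, 0) + torusChar k (-1, 0) + torusChar k (0, 1) + torusChar k (0, -1)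
      + torusChar k (1, 1) + torusChar k (-1, -1)
      = ((2 * triSymbol (2 * π * (k.1.val / n)) (2 * π * (k.2.val / m)) : ℝ) : ℂ) := by
  simp only [torusChar, mul_one, mul_neg, mul_zero, AddChar.map_zero_eq_one, one_mul,
    AddChar.map_neg_eq_inv, ZMod.stdAddChar_eq_exp, triSymbol, ← Complex.exp_neg, ← Complex.exp_add]
  generalize 2 * π * (k.1.val / n) = x
  generalize 2 * π * (k.2.val / m) = y
  push_cast
  rw [mul_add, mul_add, Complex.two_cos, Complex.two_cos, Complex.two_cos]
  ring_nf

lemma triTorus_adj_add_iff {n m : ℕ} (u w : ZMod n × ZMod m) (hw : w ≠ 0) :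
    (triTorus n m).Adj u (u + w) ↔ w ∈ ({(1, 0), (-1, 0), (0, 1), (0, -1), (1, 1), (-1, -1)} :
      Set (ZMod n × ZMod m)) := by
  obtain ⟨a, b⟩ := w
  obtain ⟨x, y⟩ := u
  have hne : (x, y) ≠ (x, y) + (a, b) := fun h => hw (left_eq_add.mp h)
  rw [triTorus, SimpleGraph.fromRel_adj, and_iff_right hne]
  simp only [Prod.mk_add_mk, add_assoc, add_right_inj, add_eq_left, left_eq_add,
    add_eq_zero_iff_eq_neg, Set.mem_insert_iff, Set.mem_singleton_iff, Prod.mk.injEq]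
  tauto

lemma sum_triTorus_adj {n m : ℕ} [NeZero n] [NeZero m] (hn : 3 ≤ n) (hm : 3 ≤ m)
    [DecidableRel (triTorus n m).Adj] (u : ZMod n × ZMod m) (f : ZMod n × ZMod m → ℂ) :
    ∑ v, (if (triTorus n m).Adj u v then f v else 0) =
      f (u + (1, 0)) + f (u + (-1, 0)) + f (u + (0, 1)) + f (u + (0, -1))
      + f (u + (1, 1)) + f (u + (-1, -1)) := by
  have key (i : ℕ) (hi : 3 ≤ i) : (1 : ZMod i) ≠ 0 ∧ (1 : ZMod i) ≠ -1 := by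
    have : Fact (2 < i) := ⟨hi⟩
    have : Fact (1 < i) := ⟨by omega⟩
    exact ⟨one_ne_zero, (ZMod.neg_one_ne_one).symm⟩
  obtain ⟨hn0, hn1⟩ := key n hn
  obtain ⟨hm0, hm1⟩ := key m hm
  rw [← Equiv.sum_comp (Equiv.addLeft u), ← Finset.sum_filter]
  have hS : Finset.univ.filter (fun w => (triTorus n m).Adj u (Equiv.addLeft u w)) =
      {(1, 0), (-1, 0), (0, 1), (0, -1), (1, 1), (-1, -1)} := by
    ext w
    rw [Finset.mem_filter_univ, Equiv.coe_addLeft]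
    by_cases hw : w = 0
    · subst hw
      simp [Prod.ext_iff, hn0, hm0, hn0.symm, hm0.symm]
    · simpa using triTorus_adj_add_iff u w hw
  rw [hS]
  repeat rw [Finset.sum_insert (by simp [hn0, hm0, hn1, hm1, hn0.symm, hm0.symm, hn1.symm])]
  simp [add_assoc]

lemma graphEnergy_triTorus {n m : ℕ} [NeZero n] [NeZero m] (hn : 3 ≤ n) (hm : 3 ≤ m) :
    graphEnergy (triTorus n m) = ∑ k : ZMod n × ZMod m,
      |2 * triSymbol (2 * π * (k.1.val / n)) (2 * π * (k.2.val / m))| := by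
  classical
  have hnm : (n * m : ℂ) ≠ 0 := by simp [NeZero.ne n, NeZero.ne m]
  have key := @Matrix.IsHermitian.map_eigenvalues_eq_of_mul_eq_mul_diagonal _ _ _ _
    (@adjMatrix_isHermitian _ _ _ (triTorus n m) (Classical.decRel _))
    (Matrix.of fun u k => torusChar k u)
    (Matrix.of fun k v => torusChar k (-v) / (n * m))
    (fun k => 2 * triSymbol (2 * π * (k.1.val / n)) (2 * π * (k.2.val / m))) ?_ ?_
  · have := congrArg (fun s => (s.map (fun x : ℝ => |x|)).sum) key
    rw [Multiset.map_map, Multiset.map_map] at this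
    exact this
  · ext u v
    simp only [Matrix.mul_apply, Matrix.of_apply, ← mul_div_assoc, ← torusChar_add,
      ← Finset.sum_div, sum_torusChar, Matrix.one_apply, add_neg_eq_zero]
    split_ifs <;> simp [hnm]
  · ext u k
    rw [Matrix.mul_diagonal, ← sum_torusChar_steps]
    simp only [Matrix.mul_apply, Matrix.of_apply, Matrix.map_apply, SimpleGraph.adjMatrix_apply,
      apply_ite Complex.ofReal, Complex.ofReal_one, Complex.ofReal_zero, ite_mul, one_mul, zero_mul]
    rw [sum_triTorus_adj hn hm]
    simp only [torusChar_add]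
    ring

lemma ZMod.sum_val {M : Type*} [AddCommMonoid M] (n : ℕ) [NeZero n] (f : ℕ → M) :
    ∑ k : ZMod n, f k.val = ∑ i ∈ Finset.range n, f i := by
  obtain ⟨n, rfl⟩ := Nat.exists_eq_succ_of_ne_zero (NeZero.ne n)
  exact Fin.sum_univ_eq_sum_range f (n + 1)

/-- Error bound for left Riemann sums of a Lipschitz function over `[0, T]`. -/
lemma abs_riemannSum_sub_integral_le {T K : ℝ} (hT : 0 ≤ T) {g : ℝ → ℝ}
    (hg : ∀ x y, |g x - g y| ≤ K * |x - y|) (n : ℕ) (hn : n ≠ 0) :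
    |T / n * ∑ k ∈ Finset.range n, g (T * (k / n)) - ∫ x in (0 : ℝ)..T, g x| ≤ K * T ^ 2 / n := by
  have hK : 0 ≤ K := by simpa using (abs_nonneg _).trans (hg 1 0)
  have hn' : (0 : ℝ) < n := by positivity
  have hcont : Continuous g :=
    (LipschitzWith.of_dist_le_mul (K := ⟨K, hK⟩) fun x y => hg x y).continuous
  have hsum := intervalIntegral.sum_integral_adjacent_intervals (f := g) (n := n)
    (μ := MeasureTheory.volume) (a := fun k : ℕ => T * (k / n))
    fun k _ => hcont.intervalIntegrable _ _
  simp only [Nat.cast_zero, zero_div, mul_zero, div_self hn'.ne', mul_one] at hsum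
  have hstep (k : ℕ) : T * ((k + 1 : ℕ) / n) - T * (k / n) = T / n := by
    push_cast
    field_simp
    ring
  rw [← hsum, Finset.mul_sum, ← Finset.sum_sub_distrib]
  calc _ ≤ ∑ k ∈ Finset.range n, K * (T / n) * (T / n) := by
        refine (Finset.abs_sum_le_sum_abs _ _).trans (Finset.sum_le_sum fun k _ => ?_)
        have hle : T * ((k : ℝ) / n) ≤ T * ((k + 1 : ℕ) / n) := by
          have : 0 ≤ T / n := by positivity
          linarith [hstep k]
        have hconst : T / n * g (T * (k / n)) =
            ∫ _ in (T * ((k : ℝ) / n))..(T * ((k + 1 : ℕ) / n)), g (T * (k / n)) := by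
          rw [intervalIntegral.integral_const, hstep, smul_eq_mul]
        rw [hconst, ← intervalIntegral.integral_sub intervalIntegrable_const
          (hcont.intervalIntegrable _ _), ← Real.norm_eq_abs]
        refine (intervalIntegral.norm_integral_le_of_norm_le_const (C := K * (T / n))
          fun x hx => ?_).trans_eq ?_
        · rw [Set.uIoc_of_le hle] at hx
          rw [Real.norm_eq_abs]
          refine (hg _ _).trans (mul_le_mul_of_nonneg_left ?_ hK)
          rw [abs_le]
          constructor <;> linarith [hx.1, hx.2, hstep k]
        · rw [hstep, abs_of_nonneg (by positivity)]
    _ = K * T ^ 2 / n := by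
        rw [Finset.sum_const, Finset.card_range, nsmul_eq_mul]
        field_simp

/-- Error bound for product Riemann sums of a Lipschitz function over `[0, T]²`. -/
lemma abs_riemannSum_sub_integral_integral_le {T K : ℝ} (hT : 0 ≤ T) {f : ℝ → ℝ → ℝ}
    (h₁ : ∀ x x' y, |f x y - f x' y| ≤ K * |x - x'|)
    (h₂ : ∀ x y y', |f x y - f x y'| ≤ K * |y - y'|) (n m : ℕ) (hn : n ≠ 0) (hm : m ≠ 0) :
    |T / n * (T / m) * ∑ k ∈ Finset.range n, ∑ l ∈ Finset.range m, f (T * (k / n)) (T * (l / m))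
      - ∫ x in (0 : ℝ)..T, ∫ y in (0 : ℝ)..T, f x y| ≤ K * T ^ 3 / n + K * T ^ 3 / m := by
  have hK : 0 ≤ K := by simpa using (abs_nonneg _).trans (h₁ 1 0 0)
  have hcont (x : ℝ) : Continuous (f x) :=
    (LipschitzWith.of_dist_le_mul (K := ⟨K, hK⟩) fun y y' => h₂ x y y').continuous
  have houter := abs_riemannSum_sub_integral_le (K := K * T) hT
    (g := fun x => ∫ y in (0 : ℝ)..T, f x y) (fun x x' => by
      rw [← intervalIntegral.integral_sub ((hcont x).intervalIntegrable _ _)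
        ((hcont x').intervalIntegrable _ _), ← Real.norm_eq_abs]
      refine (intervalIntegral.norm_integral_le_of_norm_le_const (C := K * |x - x'|)
        fun y _ => h₁ x x' y).trans_eq ?_
      rw [sub_zero, abs_of_nonneg hT]
      ring) n hn
  have hinner : |T / n * (T / m) * ∑ k ∈ Finset.range n, ∑ l ∈ Finset.range m,
      f (T * (k / n)) (T * (l / m))
      - T / n * ∑ k ∈ Finset.range n, ∫ y in (0 : ℝ)..T, f (T * (k / n)) y| ≤ K * T ^ 3 / m := by
    rw [mul_assoc, ← mul_sub, Finset.mul_sum, ← Finset.sum_sub_distrib, abs_mul,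
      abs_of_nonneg (by positivity : 0 ≤ T / n)]
    calc _ ≤ T / n * ∑ k ∈ Finset.range n, K * T ^ 2 / m := by
          gcongr
          refine (Finset.abs_sum_le_sum_abs _ _).trans (Finset.sum_le_sum fun k _ => ?_)
          exact abs_riemannSum_sub_integral_le hT (h₂ _) m hm
      _ = K * T ^ 3 / m := by
          rw [Finset.sum_const, Finset.card_range, nsmul_eq_mul]
          field_simp
  refine (abs_sub_le _ _ _).trans ((add_le_add hinner houter).trans_eq ?_)
  ring

lemma abs_triSymbol_sub_left_le (x x' y : ℝ) :
    |(|triSymbol x y|) - (|triSymbol x' y|)| ≤ 2 * |x - x'| := by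
  have h := Real.abs_cos_sub_cos_le (x + y) (x' + y)
  rw [add_sub_add_right_eq_sub] at h
  calc _ ≤ |triSymbol x y - triSymbol x' y| := abs_abs_sub_abs_le _ _
    _ = |(Real.cos x - Real.cos x') + (Real.cos (x + y) - Real.cos (x' + y))| := by
        unfold triSymbol
        ring_nf
    _ ≤ _ := by
        refine (abs_add_le _ _).trans ?_
        linarith [Real.abs_cos_sub_cos_le x x']

lemma triSymbol_comm (x y : ℝ) : triSymbol x y = triSymbol y x := by
  simp only [triSymbol, add_comm x y, add_comm (Real.cos x)]

lemma triTorusEnergy_div {n m : ℕ} (hn : 3 ≤ n) (hm : 3 ≤ m) :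
    triTorusEnergy n m / ((n : ℝ) * m) = 1 / (2 * π ^ 2) * (2 * π / n * (2 * π / m) *
      ∑ k ∈ Finset.range n, ∑ l ∈ Finset.range m,
        |triSymbol (2 * π * (k / n)) (2 * π * (l / m))|) := by
  have : NeZero n := ⟨by omega⟩
  have : NeZero m := ⟨by omega⟩
  rw [triTorusEnergy_eq_graphEnergy, graphEnergy_triTorus hn hm, Fintype.sum_prod_type,
    ZMod.sum_val n (fun k : ℕ => ∑ l : ZMod m, |2 * triSymbol (2 * π * (k / n)) (2 * π * (l.val / m))|)]
  have h (k : ℕ) := ZMod.sum_val m (fun l : ℕ => |2 * triSymbol (2 * π * (k / n)) (2 * π * (l / m))|)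
  simp only [h]
  simp only [abs_mul, abs_two, ← Finset.mul_sum]
  have hn0 : (n : ℝ) ≠ 0 := NeZero.ne _
  have hm0 : (m : ℝ) ≠ 0 := NeZero.ne _
  field_simp

/-- the energy per vertex of the toroidal triangular lattice converges,
as `n, m → ∞` jointly, to `(1/(2π²)) ∫₀^{2π} ∫₀^{2π} |cos x + cos y + cos(x+y)| dx dy`. -/
theorem energy_per_vertex_triTorus :
    Tendsto (fun p : ℕ × ℕ => triTorusEnergy p.1 p.2 / ((p.1 : ℝ) * (p.2 : ℝ)))
      (atTop ×ˢ atTop)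
      (nhds ((1 / (2 * π ^ 2)) *
        ∫ x in (0:ℝ)..2 * π, ∫ y in (0:ℝ)..2 * π,
          |Real.cos x + Real.cos y + Real.cos (x + y)|)) := by
  have hev : ∀ᶠ p : ℕ × ℕ in atTop ×ˢ atTop, 3 ≤ p.1 ∧ 3 ≤ p.2 :=
    (eventually_ge_atTop 3).prod_mk (eventually_ge_atTop 3)
  refine Tendsto.congr' (hev.mono fun p hp => (triTorusEnergy_div hp.1 hp.2).symm) ?_
  refine Tendsto.const_mul _ (tendsto_iff_norm_sub_tendsto_zero.mpr ?_)
  have hbound : Tendsto (fun p : ℕ × ℕ => 2 * (2 * π) ^ 3 / (p.1 : ℝ) + 2 * (2 * π) ^ 3 / (p.2 : ℝ))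
      (atTop ×ˢ atTop) (nhds 0) := by
    rw [← add_zero (0 : ℝ)]
    exact ((tendsto_const_div_atTop_nhds_zero_nat (2 * (2 * π) ^ 3)).comp tendsto_fst).add
      ((tendsto_const_div_atTop_nhds_zero_nat (2 * (2 * π) ^ 3)).comp tendsto_snd)
  refine squeeze_zero' (Eventually.of_forall fun _ => norm_nonneg _) (hev.mono fun p hp => ?_) hbound
  exact abs_riemannSum_sub_integral_integral_le (f := fun x y => |triSymbol x y|)
    Real.two_pi_pos.le abs_triSymbol_sub_left_le
    (fun x y y' => by simpa only [triSymbol_comm x] using abs_triSymbol_sub_left_le y y' x)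
    p.1 p.2 (by omega) (by omega)
end
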